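/- arXiv:0812.4696 — 5 statements merged into one kernel-verified Lean document; each statement's English description precedes it below -/
import Mathlib

section
/- Let G be a countable nontrivial group admitting a right-invariant linear order, and let ι be a finite nonempty type of labels. Then the order-1 intersection-tree group T₁(G;ι) is isomorphic, as an abelian group, to the direct sum of countably many copies of ℤ and countably many copies of ℤ/2ℤ (i.e. T₁(G;ι) ≅ (⨁_{n∈ℕ} ℤ) × (⨁_{n∈ℕ} ℤ/2ℤ)). -/
namespace Paper

variable (G : Type) [Group G] (ι : Type)

/-- Relator set for the order-1 intersection-tree group `T₁(G;ι)`: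
(CYC) `Y(i,j,k;a,b,c) = Y(j,k,i;b,c,a)`;
(AS) `Y(i,j,k;a,b,c) = −Y(i,k,j;a,c,b)`;
(HOL) `Y(i,j,k;a,b,c) = Y(i,j,k;ag,bg,cg)`;
(FR) `Y(i,j,i;a,b,a) = Y(i,j,j;a,b,b)`. -/
def T1Rels : Set (FreeAbelianGroup (ι × ι × ι × G × G × G)) :=
  { x | (∃ i j k a b c, x = FreeAbelianGroup.of (i,j,k,a,b,c) - FreeAbelianGroup.of (j,k,i,b,c,a))
      ∨ (∃ i j k a b c, x = FreeAbelianGroup.of (i,j,k,a,b,c) + FreeAbelianGroup.of (i,k,j,a,c,b))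
      ∨ (∃ i j k a b c g, x = FreeAbelianGroup.of (i,j,k,a,b,c)
            - FreeAbelianGroup.of (i,j,k,a*g,b*g,c*g))
      ∨ (∃ i j a b, x = FreeAbelianGroup.of (i,j,i,a,b,a) - FreeAbelianGroup.of (i,j,j,a,b,b)) }

/-- The order-1 intersection-tree group `T₁(G;ι)`. -/
abbrev T1 := FreeAbelianGroup (ι × ι × ι × G × G × G) ⧸ AddSubgroup.closure (T1Rels G ι)

/-- Class of the generator `Y(i,j,k;a,b,c)` in `T₁(G;ι)`. -/
def Y (i j k : ι) (a b c : G) : T1 G ι :=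
  QuotientAddGroup.mk (FreeAbelianGroup.of (i,j,k,a,b,c))

/-- The pair notation `(g,h) := Y(∗,∗,∗;1,g,h)` in the single-label group `T₁(G)`. -/
def pairY (g h : G) : T1 G Unit := Y G Unit () () () 1 g h

section RightOrder

variable {G : Type} [Group G] {ι : Type}

/-- The generator `Y` as a function of three labelled group elements. -/
def triY (x y z : G ×ₗ ι) : T1 G ι :=
  Y G ι (ofLex x).2 (ofLex y).2 (ofLex z).2 (ofLex x).1 (ofLex y).1 (ofLex z).1

/-- Right translation of labelled group elements. -/
def shift (x : G ×ₗ ι) (g : G) : G ×ₗ ι := toLex ((ofLex x).1 * g, (ofLex x).2)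

/-- A homomorphism out of `T₁(G;ι)` is determined by a function on generators respecting the
relations. -/
def liftT1 {H : Type} [AddCommGroup H] (F : G ×ₗ ι → G ×ₗ ι → G ×ₗ ι → H)
    (cyc : ∀ x y z, F x y z = F y z x) (as : ∀ x y z, F x y z = -F x z y)
    (hol : ∀ x y z g, F x y z = F (shift x g) (shift y g) (shift z g))
    (fr : ∀ x y, F x y x = F x y y) : T1 G ι →+ H :=
  QuotientAddGroup.lift _
    (FreeAbelianGroup.lift fun p => F (toLex (p.2.2.2.1, p.1)) (toLex (p.2.2.2.2.1, p.2.1))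
      (toLex (p.2.2.2.2.2, p.2.2.1))) (by
    rw [AddSubgroup.closure_le]
    rintro w (⟨i, j, k, a, b, c, rfl⟩ | ⟨i, j, k, a, b, c, rfl⟩ | ⟨i, j, k, a, b, c, g, rfl⟩ |
      ⟨i, j, a, b, rfl⟩)
    · simp only [SetLike.mem_coe, AddMonoidHom.mem_ker, map_sub, FreeAbelianGroup.lift_apply_of]
      rw [cyc, sub_self]
    · simp only [SetLike.mem_coe, AddMonoidHom.mem_ker, map_add, FreeAbelianGroup.lift_apply_of]
      rw [as, neg_add_cancel]
    · simp only [SetLike.mem_coe, AddMonoidHom.mem_ker, map_sub, FreeAbelianGroup.lift_apply_of]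
      rw [hol _ _ _ g]
      exact sub_self _
    · simp only [SetLike.mem_coe, AddMonoidHom.mem_ker, map_sub, FreeAbelianGroup.lift_apply_of]
      rw [fr, sub_self])

theorem liftT1_triY {H : Type} [AddCommGroup H] (F : G ×ₗ ι → G ×ₗ ι → G ×ₗ ι → H)
    (cyc as hol fr) (x y z : G ×ₗ ι) : liftT1 F cyc as hol fr (triY x y z) = F x y z :=
  FreeAbelianGroup.lift_apply_of _ _

theorem triY_cyc (x y z : G ×ₗ ι) : triY x y z = triY y z x := by
  refine (QuotientAddGroup.eq_iff_sub_mem).2 (AddSubgroup.subset_closure (Or.inl ?_))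
  exact ⟨_, _, _, _, _, _, rfl⟩

theorem triY_swap (x y z : G ×ₗ ι) : triY x y z = -triY x z y := by
  refine (QuotientAddGroup.eq_iff_sub_mem).2 (AddSubgroup.subset_closure (Or.inr (Or.inl ?_)))
  exact ⟨_, _, _, _, _, _, sub_neg_eq_add _ _⟩

theorem triY_shift (x y z : G ×ₗ ι) (g : G) :
    triY (shift x g) (shift y g) (shift z g) = triY x y z := by
  symm
  refine (QuotientAddGroup.eq_iff_sub_mem).2
    (AddSubgroup.subset_closure (Or.inr (Or.inr (Or.inl ?_))))
  exact ⟨_, _, _, _, _, _, g, rfl⟩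

theorem triY_framing (x y : G ×ₗ ι) : triY x y x = triY x y y := by
  refine (QuotientAddGroup.eq_iff_sub_mem).2
    (AddSubgroup.subset_closure (Or.inr (Or.inr (Or.inr ?_))))
  exact ⟨_, _, _, _, rfl⟩

theorem two_zsmul_triY (x y : G ×ₗ ι) : (2 : ℤ) • triY x y y = 0 := by
  rw [two_zsmul]
  exact add_eq_zero_iff_eq_neg.2 (triY_swap x y y)

theorem T1_hom_ext {H : Type} [AddCommGroup H] {f g : T1 G ι →+ H}
    (h : ∀ x y z, f (triY x y z) = g (triY x y z)) : f = g := by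
  refine QuotientAddGroup.addMonoidHom_ext _ (FreeAbelianGroup.lift_ext _ _ fun p => ?_)
  obtain ⟨i, j, k, a, b, c⟩ := p
  exact h (toLex (a, i)) (toLex (b, j)) (toLex (c, k))

@[simp] theorem shift_shift (x : G ×ₗ ι) (g h : G) : shift (shift x g) h = shift x (g * h) := by
  simp [shift, mul_assoc]

@[simp] theorem shift_one (x : G ×ₗ ι) : shift x 1 = x := by
  simp [shift]

@[simp] theorem ofLex_shift_fst (x : G ×ₗ ι) (g : G) : (ofLex (shift x g)).1 = (ofLex x).1 * g :=
  rfl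

theorem shift_injective (g : G) : Function.Injective fun x : G ×ₗ ι => shift x g := by
  intro x y h
  simpa using congrArg (fun w => shift w g⁻¹) h

variable [LinearOrder G] [LinearOrder ι]

theorem shift_lt_shift (hro : ∀ f g h : G, g < h → g * f < h * f) {x y : G ×ₗ ι} (h : x < y)
    (g : G) : shift x g < shift y g := by
  rw [Prod.Lex.lt_iff] at h ⊢
  rcases h with h | ⟨h, h'⟩
  · exact Or.inl (hro _ _ _ h)
  · exact Or.inr ⟨congrArg (· * g) h, h'⟩

theorem shift_strictMono (hro : ∀ f g h : G, g < h → g * f < h * f) (g : G) :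
    StrictMono fun x : G ×ₗ ι => shift x g :=
  fun _ _ h => shift_lt_shift hro h g

variable (G ι) in
/-- Representatives of the orbits of three-element sets of labelled group elements. -/
abbrev Triples : Type :=
  {p : (G ×ₗ ι) × (G ×ₗ ι) × (G ×ₗ ι) // (ofLex p.1).1 = 1 ∧ p.1 < p.2.1 ∧ p.2.1 < p.2.2}

variable (G ι) in
/-- Representatives of the orbits of unordered pairs of labelled group elements. -/
abbrev Pairs : Type :=
  {p : (G ×ₗ ι) × (G ×ₗ ι) // (ofLex p.1).1 = 1 ∧ p.1 ≤ p.2}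

/-- The basis vector of the orbit of an increasing triple, and zero on other triples. -/
noncomputable def tripleVec (hro : ∀ f g h : G, g < h → g * f < h * f) (x y z : G ×ₗ ι) :
    Triples G ι →₀ ℤ :=
  if h : x < y ∧ y < z then
    Finsupp.single ⟨(shift x (ofLex x).1⁻¹, shift y (ofLex x).1⁻¹, shift z (ofLex x).1⁻¹),
      by simp, shift_lt_shift hro h.1 _, shift_lt_shift hro h.2 _⟩ 1
  else 0

/-- The basis vector of the orbit of a weakly increasing pair, and zero on other pairs. -/
noncomputable def pairVec (hro : ∀ f g h : G, g < h → g * f < h * f) (x y : G ×ₗ ι) :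
    Pairs G ι →₀ ZMod 2 :=
  if h : x ≤ y then
    Finsupp.single ⟨(shift x (ofLex x).1⁻¹, shift y (ofLex x).1⁻¹),
      by simp, (shift_strictMono hro _).monotone h⟩ 1
  else 0

theorem tripleVec_shift (hro : ∀ f g h : G, g < h → g * f < h * f) (x y z : G ×ₗ ι) (g : G) :
    tripleVec hro (shift x g) (shift y g) (shift z g) = tripleVec hro x y z := by
  have hlt : ∀ u v : G ×ₗ ι, shift u g < shift v g ↔ u < v :=
    fun _ _ => StrictMono.lt_iff_lt (f := fun x : G ×ₗ ι => shift x g) (shift_strictMono hro g)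
  simp [tripleVec, hlt]

theorem pairVec_shift (hro : ∀ f g h : G, g < h → g * f < h * f) (x y : G ×ₗ ι) (g : G) :
    pairVec hro (shift x g) (shift y g) = pairVec hro x y := by
  have hle : ∀ u v : G ×ₗ ι, shift u g ≤ shift v g ↔ u ≤ v :=
    fun _ _ => StrictMono.le_iff_le (f := fun x : G ×ₗ ι => shift x g) (shift_strictMono hro g)
  simp [pairVec, hle]

/-- The alternating extension of `tripleVec`. -/
noncomputable def altVec (hro : ∀ f g h : G, g < h → g * f < h * f) (x y z : G ×ₗ ι) :
    Triples G ι →₀ ℤ :=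
  tripleVec hro x y z + tripleVec hro y z x + tripleVec hro z x y
    - tripleVec hro x z y - tripleVec hro z y x - tripleVec hro y x z

/-- The pair of extreme points of a triple with a repetition, and zero on other triples. -/
noncomputable def degVec (hro : ∀ f g h : G, g < h → g * f < h * f) (x y z : G ×ₗ ι) :
    Pairs G ι →₀ ZMod 2 :=
  if x = y ∨ y = z ∨ z = x then pairVec hro (min x (min y z)) (max x (max y z)) else 0

theorem add_self_eq_zero_of_zmod_two {α : Type} (v : α →₀ ZMod 2) : v + v = 0 := by
  ext a
  exact CharTwo.add_self_eq_zero _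

theorem degVec_cyc (hro : ∀ f g h : G, g < h → g * f < h * f) (x y z : G ×ₗ ι) :
    degVec hro x y z = degVec hro y z x := by
  have h : (x = y ∨ y = z ∨ z = x) ↔ (y = z ∨ z = x ∨ x = y) := by tauto
  simp only [degVec, h, min_comm x, max_comm x, min_assoc, max_assoc]

theorem degVec_swap (hro : ∀ f g h : G, g < h → g * f < h * f) (x y z : G ×ₗ ι) :
    degVec hro x y z = degVec hro x z y := by
  have h : (x = y ∨ y = z ∨ z = x) ↔ (x = z ∨ z = y ∨ y = x) := by
    simp only [eq_comm]; tauto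
  simp only [degVec, h, min_comm y, max_comm y]

theorem degVec_shift (hro : ∀ f g h : G, g < h → g * f < h * f) (x y z : G ×ₗ ι) (g : G) :
    degVec hro (shift x g) (shift y g) (shift z g) = degVec hro x y z := by
  have hmin : ∀ u v : G ×ₗ ι, min (shift u g) (shift v g) = shift (min u v) g :=
    fun _ _ => (Monotone.map_min (f := fun x : G ×ₗ ι => shift x g)
      (shift_strictMono hro g).monotone).symm
  have hmax : ∀ u v : G ×ₗ ι, max (shift u g) (shift v g) = shift (max u v) g :=
    fun _ _ => (Monotone.map_max (f := fun x : G ×ₗ ι => shift x g)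
      (shift_strictMono hro g).monotone).symm
  have heq : ∀ u v : G ×ₗ ι, shift u g = shift v g ↔ u = v :=
    fun u v => (shift_injective g).eq_iff
  simp only [degVec, hmin, hmax, heq, pairVec_shift]

theorem degVec_framing (hro : ∀ f g h : G, g < h → g * f < h * f) (x y : G ×ₗ ι) :
    degVec hro x y x = degVec hro x y y := by
  simp [degVec, min_comm y, max_comm y]

/-- The coordinates of an element of `T₁(G;ι)`. -/
noncomputable def coords (hro : ∀ f g h : G, g < h → g * f < h * f) :
    T1 G ι →+ (Triples G ι →₀ ℤ) × (Pairs G ι →₀ ZMod 2) :=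
  liftT1 (fun x y z => (altVec hro x y z, degVec hro x y z))
    (fun x y z => Prod.ext (by simp only [altVec]; abel) (degVec_cyc hro x y z))
    (fun x y z => Prod.ext (by simp only [altVec, Prod.fst_neg]; abel) (by
      rw [Prod.snd_neg, eq_neg_iff_add_eq_zero]
      dsimp only
      rw [degVec_swap, add_self_eq_zero_of_zmod_two]))
    (fun x y z g => by simp only [altVec, tripleVec_shift, degVec_shift])
    (fun x y => Prod.ext (by simp only [altVec]; abel) (degVec_framing hro x y))

theorem coords_triY (hro : ∀ f g h : G, g < h → g * f < h * f) (x y z : G ×ₗ ι) :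
    coords hro (triY x y z) = (altVec hro x y z, degVec hro x y z) :=
  liftT1_triY _ _ _ _ _ _ _ _

variable (G ι) in
/-- The element of `T₁(G;ι)` with given coordinates. -/
noncomputable def ofCoords :
    (Triples G ι →₀ ℤ) × (Pairs G ι →₀ ZMod 2) →+ T1 G ι :=
  AddMonoidHom.coprod
    (Finsupp.liftAddHom fun p => zmultiplesHom _ (triY p.1.1 p.1.2.1 p.1.2.2))
    (Finsupp.liftAddHom fun p => ZMod.lift 2 ⟨zmultiplesHom _ (triY p.1.1 p.1.2 p.1.2), by
      simpa using two_zsmul_triY p.1.1 p.1.2⟩)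

theorem ofCoords_tripleVec (hro : ∀ f g h : G, g < h → g * f < h * f) {x y z : G ×ₗ ι}
    (hxy : x < y) (hyz : y < z) : ofCoords G ι (tripleVec hro x y z, 0) = triY x y z := by
  simp [ofCoords, tripleVec, hxy, hyz, triY_shift]

theorem ofCoords_pairVec (hro : ∀ f g h : G, g < h → g * f < h * f) {x y : G ×ₗ ι}
    (hxy : x ≤ y) : ofCoords G ι (0, pairVec hro x y) = triY x y y := by
  have h := ZMod.lift_coe 2 ⟨zmultiplesHom (T1 G ι) (triY x y y), by
    simpa using two_zsmul_triY x y⟩ 1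
  simp only [Int.cast_one] at h
  simp [ofCoords, pairVec, hxy, triY_shift, h]

theorem altVec_of_lt (hro : ∀ f g h : G, g < h → g * f < h * f) {x y z : G ×ₗ ι}
    (hxy : x < y) (hyz : y < z) : altVec hro x y z = tripleVec hro x y z := by
  have hxz := hxy.trans hyz
  simp [altVec, tripleVec, hxy.not_gt, hyz.not_gt, hxz.not_gt]

theorem degVec_of_lt (hro : ∀ f g h : G, g < h → g * f < h * f) {x y z : G ×ₗ ι}
    (hxy : x < y) (hyz : y < z) : degVec hro x y z = 0 := by
  simp [degVec, hxy.ne, hyz.ne, (hxy.trans hyz).ne']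

theorem altVec_self_right (hro : ∀ f g h : G, g < h → g * f < h * f) (x y : G ×ₗ ι) :
    altVec hro x y y = 0 := by
  simp only [altVec]; abel

theorem degVec_self_right (hro : ∀ f g h : G, g < h → g * f < h * f) {x y : G ×ₗ ι}
    (hxy : x ≤ y) : degVec hro x y y = pairVec hro x y := by
  simp [degVec, hxy]

theorem ofCoords_coords_of_le (hro : ∀ f g h : G, g < h → g * f < h * f) {x y z : G ×ₗ ι}
    (hxy : x ≤ y) (hyz : y ≤ z) : ofCoords G ι (coords hro (triY x y z)) = triY x y z := by
  have key : ∀ {u v : G ×ₗ ι}, u ≤ v → ofCoords G ι (coords hro (triY u v v)) = triY u v v := by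
    intro u v h
    rw [coords_triY, altVec_self_right, degVec_self_right hro h, ofCoords_pairVec hro h]
  rcases hxy.lt_or_eq with hxy | rfl
  · rcases hyz.lt_or_eq with hyz | rfl
    · rw [coords_triY, altVec_of_lt hro hxy hyz, degVec_of_lt hro hxy hyz,
        ofCoords_tripleVec hro hxy hyz]
    · exact key hxy.le
  · rw [triY_cyc, triY_framing]
    exact key hyz

theorem ofCoords_coords (hro : ∀ f g h : G, g < h → g * f < h * f) (t : T1 G ι) :
    ofCoords G ι (coords hro t) = t := by
  suffices (ofCoords G ι).comp (coords hro) = AddMonoidHom.id _ from DFunLike.congr_fun this t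
  refine T1_hom_ext fun x y z => ?_
  change ofCoords G ι (coords hro (triY x y z)) = triY x y z
  have swap : ∀ {u v w : G ×ₗ ι}, ofCoords G ι (coords hro (triY u v w)) = triY u v w →
      ofCoords G ι (coords hro (triY u w v)) = triY u w v := by
    intro u v w h
    rw [triY_swap u w v, map_neg, map_neg, h]
  have rot : ∀ {u v w : G ×ₗ ι}, ofCoords G ι (coords hro (triY u v w)) = triY u v w →
      ofCoords G ι (coords hro (triY w u v)) = triY w u v := by
    intro u v w h
    rwa [triY_cyc w u v]
  have sorted := fun u v w : G ×ₗ ι => ofCoords_coords_of_le hro (x := u) (y := v) (z := w)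
  rcases le_total x y with h₁ | h₁ <;> rcases le_total y z with h₂ | h₂ <;>
    rcases le_total x z with h₃ | h₃
  · exact sorted _ _ _ h₁ h₂
  · exact sorted _ _ _ h₁ h₂
  · exact swap (sorted _ _ _ h₃ h₂)
  · exact rot (rot (sorted _ _ _ h₃ h₁))
  · exact rot (swap (sorted _ _ _ h₁ h₃))
  · exact rot (sorted _ _ _ h₂ h₃)
  · exact swap (rot (sorted _ _ _ h₂ h₁))
  · exact swap (rot (sorted _ _ _ h₂ h₁))

theorem coords_ofCoords (hro : ∀ f g h : G, g < h → g * f < h * f)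
    (v : (Triples G ι →₀ ℤ) × (Pairs G ι →₀ ZMod 2)) : coords hro (ofCoords G ι v) = v := by
  have triple : ∀ p : Triples G ι,
      Finsupp.single p (1 : ℤ) = tripleVec hro p.1.1 p.1.2.1 p.1.2.2 := by
    rintro ⟨⟨x, y, z⟩, hx, hxy, hyz⟩
    dsimp only at hx hxy hyz
    simp [tripleVec, hxy, hyz, hx]
  have pair : ∀ p : Pairs G ι, Finsupp.single p (1 : ZMod 2) = pairVec hro p.1.1 p.1.2 := by
    rintro ⟨⟨x, y⟩, hx, hxy⟩
    dsimp only at hx hxy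
    simp [pairVec, hxy, hx]
  have fst : ((coords hro).comp (ofCoords G ι)).comp (AddMonoidHom.inl _ _) =
      AddMonoidHom.inl _ _ := by
    refine Finsupp.addHom_ext' fun p => AddMonoidHom.ext_int ?_
    change coords hro (ofCoords G ι (Finsupp.single p (1 : ℤ), 0)) = (Finsupp.single p (1 : ℤ), 0)
    rw [triple, ofCoords_tripleVec hro p.2.2.1 p.2.2.2, coords_triY,
      altVec_of_lt hro p.2.2.1 p.2.2.2, degVec_of_lt hro p.2.2.1 p.2.2.2]
  have snd : ((coords hro).comp (ofCoords G ι)).comp (AddMonoidHom.inr _ _) =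
      AddMonoidHom.inr _ _ := by
    refine Finsupp.addHom_ext' fun p => ?_
    refine (AddMonoidHom.cancel_right (ZMod.intCast_surjective (n := 2))
      (f := Int.castAddHom (ZMod 2))).1 (AddMonoidHom.ext_int ?_)
    change coords hro (ofCoords G ι (0, Finsupp.single p ((1 : ℤ) : ZMod 2))) =
      (0, Finsupp.single p ((1 : ℤ) : ZMod 2))
    rw [Int.cast_one, pair, ofCoords_pairVec hro p.2.2, coords_triY, altVec_self_right,
      degVec_self_right hro p.2.2]
  have h₁ := DFunLike.congr_fun fst v.1
  have h₂ := DFunLike.congr_fun snd v.2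
  simp only [AddMonoidHom.comp_apply, AddMonoidHom.inl_apply, AddMonoidHom.inr_apply] at h₁ h₂
  rw [← Prod.fst_add_snd v, map_add, map_add, h₁, h₂]

/-- `T₁(G;ι)` is a direct sum of copies of `ℤ` indexed by triples and of `ℤ/2ℤ` indexed by
pairs. -/
noncomputable def coordsEquiv (hro : ∀ f g h : G, g < h → g * f < h * f) :
    T1 G ι ≃+ (Triples G ι →₀ ℤ) × (Pairs G ι →₀ ZMod 2) where
  __ := coords hro
  invFun := ofCoords G ι
  left_inv := ofCoords_coords hro
  right_inv := coords_ofCoords hro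

theorem exists_one_lt_of_right_order [Nontrivial G]
    (hro : ∀ f g h : G, g < h → g * f < h * f) : ∃ g : G, 1 < g := by
  obtain ⟨g, hg⟩ := exists_ne (1 : G)
  rcases hg.lt_or_gt with h | h
  · exact ⟨g⁻¹, by simpa using hro g⁻¹ g 1 h⟩
  · exact ⟨g, h⟩

theorem strictMono_pow_of_right_order (hro : ∀ f g h : G, g < h → g * f < h * f) {g : G}
    (hg : 1 < g) : StrictMono fun n : ℕ => g ^ n :=
  strictMono_nat_of_lt_succ fun n => by simpa [pow_succ'] using hro (g ^ n) 1 g hg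

theorem infinite_triples_and_pairs [Nontrivial G] [Nonempty ι]
    (hro : ∀ f g h : G, g < h → g * f < h * f) :
    Infinite (Triples G ι) ∧ Infinite (Pairs G ι) := by
  obtain ⟨g, hg⟩ := exists_one_lt_of_right_order hro
  have mono := strictMono_pow_of_right_order hro hg
  obtain ⟨i⟩ := ‹Nonempty ι›
  let pt : ℕ → G ×ₗ ι := fun n => toLex (g ^ n, i)
  have hpt : StrictMono pt := fun m n h => Prod.Lex.toLex_lt_toLex.2 (Or.inl (mono h))
  have one : (ofLex (pt 0)).1 = 1 := pow_zero g
  constructor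
  · refine Infinite.of_injective (fun n => ⟨(pt 0, pt (n + 1), pt (n + 2)), one,
      hpt (by simp), hpt (by simp)⟩ : ℕ → Triples G ι) fun m n h => ?_
    have := hpt.injective (congrArg (fun p : Triples G ι => p.1.2.1) h)
    omega
  · refine Infinite.of_injective (fun n => ⟨(pt 0, pt n), one, hpt.monotone (by simp)⟩ :
      ℕ → Pairs G ι) fun m n h => ?_
    exact hpt.injective (congrArg (fun p : Pairs G ι => p.1.2) h)

end RightOrder

/-- Finitely supported functions on a countably infinite type form a direct sum over `ℕ`. -/
theorem nonempty_finsupp_equiv_directSum (α M : Type) [Countable α] [Infinite α]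
    [AddCommGroup M] : Nonempty ((α →₀ M) ≃+ DirectSum ℕ fun _ => M) := by
  classical
  obtain ⟨e⟩ := nonempty_equiv_of_countable (α := α) (β := ℕ)
  exact ⟨(Finsupp.domCongr e).trans (finsuppLEquivDirectSum ℤ M ℕ).toAddEquiv⟩

/-- if `G` is a countable nontrivial group with a right-invariant linear
order and `ι` is a finite nonempty label type, then
`T₁(G;ι) ≅ (⨁_{n∈ℕ} ℤ) × (⨁_{n∈ℕ} ℤ/2ℤ)` as abelian groups. -/
theorem T1_of_right_orderable (G : Type) [Group G] [Countable G] [Nontrivial G]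
    [LinearOrder G] (hro : ∀ f g h : G, g < h → g * f < h * f)
    (ι : Type) [Fintype ι] [Nonempty ι] :
    Nonempty (T1 G ι ≃+ (DirectSum ℕ (fun _ => ℤ) × DirectSum ℕ (fun _ => ZMod 2))) := by
  let : LinearOrder ι := LinearOrder.lift' _ (Fintype.equivFin ι).injective
  have : Countable (G ×ₗ ι) := inferInstanceAs (Countable (G × ι))
  obtain ⟨_, _⟩ := infinite_triples_and_pairs (G := G) (ι := ι) hro
  obtain ⟨e₁⟩ := nonempty_finsupp_equiv_directSum (Triples G ι) ℤ
  obtain ⟨e₂⟩ := nonempty_finsupp_equiv_directSum (Pairs G ι) (ZMod 2)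
  exact ⟨(coordsEquiv hro).trans (e₁.prodCongr e₂)⟩

end Paper
end

section
/- Let G be a group and let T₁(G) be the single-label order-1 intersection-tree group, with (g,h) denoting the class of Y(∗,∗,∗;1,g,h). Then for every g ∈ G the following identities hold in T₁(G): (g,g) = (g⁻¹,g⁻¹) = (g⁻¹,1) = (1,g⁻¹) = (g,1) = (1,g), and moreover 2·(g,g) = 0. -/
namespace Paper

variable (G : Type) [Group G] (ι : Type)

section Relations

variable {G ι}

theorem Y_cyc (i j k : ι) (a b c : G) : Y G ι i j k a b c = Y G ι j k i b c a := by
  refine QuotientAddGroup.eq_iff_sub_mem.mpr (AddSubgroup.subset_closure ?_)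
  exact Or.inl ⟨i, j, k, a, b, c, rfl⟩

theorem Y_antisymm (i j k : ι) (a b c : G) : Y G ι i j k a b c = -Y G ι i k j a c b := by
  refine QuotientAddGroup.eq_iff_sub_mem.mpr (AddSubgroup.subset_closure ?_)
  exact Or.inr (Or.inl ⟨i, j, k, a, b, c, sub_neg_eq_add _ _⟩)

theorem Y_mul_right (i j k : ι) (a b c g : G) :
    Y G ι i j k a b c = Y G ι i j k (a * g) (b * g) (c * g) := by
  refine QuotientAddGroup.eq_iff_sub_mem.mpr (AddSubgroup.subset_closure ?_)
  exact Or.inr (Or.inr (Or.inl ⟨i, j, k, a, b, c, g, rfl⟩))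

theorem Y_framing (i j : ι) (a b : G) : Y G ι i j i a b a = Y G ι i j j a b b := by
  refine QuotientAddGroup.eq_iff_sub_mem.mpr (AddSubgroup.subset_closure ?_)
  exact Or.inr (Or.inr (Or.inr ⟨i, j, a, b, rfl⟩))

theorem pairY_swap (g h : G) : pairY G g h = -pairY G h g :=
  Y_antisymm () () () 1 g h

theorem neg_pairY_self (g : G) : -pairY G g g = pairY G g g :=
  (pairY_swap g g).symm

theorem pairY_one_right (g : G) : pairY G g 1 = pairY G g g :=
  Y_framing () () 1 g

theorem pairY_one_left (g : G) : pairY G 1 g = pairY G g g := by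
  rw [pairY_swap, pairY_one_right, neg_pairY_self]

theorem pairY_one_left_inv (g : G) : pairY G 1 g⁻¹ = pairY G g g := by
  have h := Y_mul_right () () () 1 g g g⁻¹
  rw [one_mul, mul_inv_cancel, Y_cyc () () () g⁻¹ 1 1] at h
  exact h.symm

end Relations

/-- the orbit identities
`(g,g) = (g⁻¹,g⁻¹) = (g⁻¹,1) = (1,g⁻¹) = (g,1) = (1,g)` in `T₁(G)`, and `2·(g,g) = 0`. -/
theorem torsion_orbit_identities (G : Type) [Group G] (g : G) :
    pairY G g g = pairY G g⁻¹ g⁻¹ ∧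
    pairY G g g = pairY G g⁻¹ 1 ∧
    pairY G g g = pairY G 1 g⁻¹ ∧
    pairY G g g = pairY G g 1 ∧
    pairY G g g = pairY G 1 g ∧
    2 • pairY G g g = 0 := by
  have hinv : pairY G g g = pairY G g⁻¹ g⁻¹ := by
    rw [← pairY_one_left_inv, pairY_one_left]
  refine ⟨hinv, ?_, (pairY_one_left_inv g).symm, (pairY_one_right g).symm,
    (pairY_one_left g).symm, ?_⟩
  · rw [pairY_one_right, hinv]
  · rw [two_nsmul, ← eq_neg_iff_add_eq_zero, neg_pairY_self]

end Paper
end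

section
/- Let G be a group equipped with a right-invariant linear order <, and let g,h ∈ G be such that 1, g, h are pairwise distinct. Then among the six ordered pairs (g,h), (g⁻¹, h·g⁻¹), (h·g⁻¹, g⁻¹), (g·h⁻¹, h⁻¹), (h⁻¹, g·h⁻¹), (h,g), exactly one pair (a,b) satisfies 1 < a < b. -/
/-- if `G` carries a right-invariant linear order and `1, g, h` are
pairwise distinct, then among the six pairs
`(g,h), (g⁻¹, hg⁻¹), (hg⁻¹, g⁻¹), (gh⁻¹, h⁻¹), (h⁻¹, gh⁻¹), (h,g)`
exactly one pair `(a,b)` satisfies `1 < a < b`. -/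
theorem unique_normal_form_pair (G : Type) [Group G] [LinearOrder G]
    (hro : ∀ f g h : G, g < h → g * f < h * f)
    (g h : G) (hg : g ≠ 1) (hh : h ≠ 1) (hgh : g ≠ h) :
    ∃! i : Fin 6,
      1 < (![(g, h), (g⁻¹, h * g⁻¹), (h * g⁻¹, g⁻¹), (g * h⁻¹, h⁻¹), (h⁻¹, g * h⁻¹),
            (h, g)] i).1 ∧
      (![(g, h), (g⁻¹, h * g⁻¹), (h * g⁻¹, g⁻¹), (g * h⁻¹, h⁻¹), (h⁻¹, g * h⁻¹),
            (h, g)] i).1 <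
        (![(g, h), (g⁻¹, h * g⁻¹), (h * g⁻¹, g⁻¹), (g * h⁻¹, h⁻¹), (h⁻¹, g * h⁻¹),
            (h, g)] i).2 := by
  have cancel (f a b : G) : a * f < b * f ↔ a < b :=
    ⟨fun hab => by simpa using hro f⁻¹ _ _ hab, hro f a b⟩
  have one_lt_inv (a : G) : 1 < a⁻¹ ↔ a < 1 := by simpa using (cancel a 1 a⁻¹).symm
  have one_lt_mul_inv (a b : G) : 1 < a * b⁻¹ ↔ b < a := by
    simpa using (cancel b 1 (a * b⁻¹)).symm
  have inv_lt_mul_inv (a b : G) : b⁻¹ < a * b⁻¹ ↔ 1 < a := by simpa using cancel b⁻¹ 1 a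
  have mul_inv_lt_inv (a b : G) : a * b⁻¹ < b⁻¹ ↔ a < 1 := by simpa using cancel b⁻¹ a 1
  simp only [ExistsUnique, Fin.exists_fin_succ, Fin.forall_fin_succ, Matrix.cons_val_zero,
    Matrix.cons_val_succ, one_lt_inv, one_lt_mul_inv, inv_lt_mul_inv, mul_inv_lt_inv]
  rcases lt_or_gt_of_ne hg with h₁ | h₁ <;> rcases lt_or_gt_of_ne hh with h₂ | h₂ <;>
    rcases lt_or_gt_of_ne hgh with h₃ | h₃ <;>
    simp [h₁, h₂, h₃, h₁.not_gt, h₂.not_gt, h₃.not_gt] <;> order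
end

section
/- The group presented by two generators a, f subject to the single relator a·f·a⁻¹·f (i.e. the presented group ⟨a,f | a f a⁻¹ = f⁻¹⟩) is isomorphic to the Klein-bottle group K, via the homomorphism sending the generator a to (1,0) and the generator f to (0,1). Equivalently, in the presented group every element can be written uniquely in the normal form aⁿ f^l with n,l ∈ ℤ. -/
namespace Paper

/-- The Klein-bottle group: underlying set `ℤ × ℤ` with multiplication
`(n,l)·(m,k) = (n+m, (−1)^m·l + k)`. -/
@[ext] structure KB where
  /-- exponent of `a` -/
  n : ℤ
  /-- exponent of `f` -/
  l : ℤ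

namespace KB

instance : One KB := ⟨⟨0, 0⟩⟩
instance : Mul KB := ⟨fun x y => ⟨x.n + y.n, (y.n.negOnePow : ℤ) * x.l + y.l⟩⟩
instance : Inv KB := ⟨fun x => ⟨-x.n, -((x.n.negOnePow : ℤ) * x.l)⟩⟩

@[simp] lemma one_n : (1 : KB).n = 0 := rfl
@[simp] lemma one_l : (1 : KB).l = 0 := rfl
@[simp] lemma mul_n (x y : KB) : (x * y).n = x.n + y.n := rfl
@[simp] lemma mul_l (x y : KB) : (x * y).l = (y.n.negOnePow : ℤ) * x.l + y.l := rfl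
@[simp] lemma inv_n (x : KB) : x⁻¹.n = -x.n := rfl
@[simp] lemma inv_l (x : KB) : x⁻¹.l = -((x.n.negOnePow : ℤ) * x.l) := rfl

instance : Group KB where
  mul_assoc x y z := by
    ext
    · simp [add_assoc]
    · simp [Int.negOnePow_add, Units.val_mul]
      ring
  one_mul x := by ext <;> simp
  mul_one x := by ext <;> simp
  inv_mul_cancel x := by
    ext
    · simp
    · simp
      rw [← mul_assoc, ← Units.val_mul, Int.units_mul_self]
      simp

/-- The generator `a = (1,0)`, a core of the Möbius band. -/
def a : KB := ⟨1, 0⟩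

/-- The generator `f = (0,1)`, a circle fiber. -/
def f : KB := ⟨0, 1⟩

end KB

/-- The single relator `a·f·a⁻¹·f` of the presentation `⟨a,f | a f a⁻¹ = f⁻¹⟩`,
with generator `0` playing the role of `a` and generator `1` playing the role of `f`. -/
def kleinRels : Set (FreeGroup (Fin 2)) :=
  {FreeGroup.of 0 * FreeGroup.of 1 * (FreeGroup.of 0)⁻¹ * FreeGroup.of 1}

/-- If `x * y * x⁻¹ = y⁻¹`, then moving a power of `y` past `x ^ m` multiplies its exponent
by `(-1) ^ m`. -/
lemma zpow_mul_zpow_of_conj_eq_inv {G : Type*} [Group G] {x y : G} (h : x * y * x⁻¹ = y⁻¹)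
    (l m : ℤ) : y ^ l * x ^ m = x ^ m * y ^ ((m.negOnePow : ℤ) * l) := by
  have hl (k : ℤ) : SemiconjBy x (y ^ (-k)) (y ^ k) := by
    have hs : SemiconjBy x y y⁻¹ := mul_inv_eq_iff_eq_mul.mp h
    simpa using hs.zpow_right (-k)
  suffices hm : ∀ l : ℤ, SemiconjBy (x ^ m) (y ^ ((m.negOnePow : ℤ) * l)) (y ^ l) from
    (hm l).eq.symm
  induction m with
  | zero => simp
  | succ i ih =>
    intro l
    rw [zpow_add_one, Int.negOnePow_succ, Units.val_neg, neg_mul]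
    exact (ih l).mul_left (hl _)
  | pred i ih =>
    intro l
    rw [zpow_sub_one, Int.negOnePow_sub, Int.negOnePow_one, mul_neg_one, Units.val_neg, neg_mul]
    have hk := (hl (-(((-i : ℤ).negOnePow : ℤ) * l))).inv_symm_left
    rw [neg_neg] at hk
    exact (ih l).mul_left hk

namespace KB

lemma a_zpow (n : ℤ) : a ^ n = ⟨n, 0⟩ := by
  induction n with
  | zero => rfl
  | succ i ih => rw [zpow_add_one, ih]; ext <;> simp [a]
  | pred i ih => rw [zpow_sub_one, ih]; ext <;> simp [a, sub_eq_add_neg]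

lemma f_zpow (l : ℤ) : f ^ l = ⟨0, l⟩ := by
  induction l with
  | zero => rfl
  | succ i ih => rw [zpow_add_one, ih]; ext <;> simp [f]
  | pred i ih => rw [zpow_sub_one, ih]; ext <;> simp [f, sub_eq_add_neg]

lemma a_zpow_mul_f_zpow (n l : ℤ) : a ^ n * f ^ l = ⟨n, l⟩ := by
  rw [a_zpow, f_zpow]
  ext <;> simp

/-- The homomorphism `(n, l) ↦ xⁿ yˡ` out of the Klein-bottle group. -/
def lift {G : Type*} [Group G] {x y : G} (h : x * y * x⁻¹ = y⁻¹) : KB →* G :=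
  MonoidHom.mk' (fun p => x ^ p.n * y ^ p.l) fun p q => by
    rw [mul_n, mul_l, zpow_add, zpow_add, mul_assoc, mul_assoc, ← mul_assoc (y ^ p.l),
      zpow_mul_zpow_of_conj_eq_inv h, mul_assoc]

@[simp] lemma lift_apply {G : Type*} [Group G] {x y : G} (h : x * y * x⁻¹ = y⁻¹) (p : KB) :
    lift h p = x ^ p.n * y ^ p.l := rfl

end KB

lemma of_conj_eq_inv :
    (PresentedGroup.of 0 : PresentedGroup kleinRels) * PresentedGroup.of 1 *
      (PresentedGroup.of 0)⁻¹ = (PresentedGroup.of 1)⁻¹ :=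
  eq_inv_of_mul_eq_one_left (PresentedGroup.one_of_mem (rels := kleinRels) rfl)

lemma lift_kleinRels_eq_one : ∀ r ∈ kleinRels, FreeGroup.lift ![KB.a, KB.f] r = 1 := by
  rintro r rfl
  ext <;> simp [KB.a, KB.f]

/-- The isomorphism from the presented group to the Klein-bottle group sending the generators
to `a` and `f`. -/
def presentedGroupEquiv : PresentedGroup kleinRels ≃* KB :=
  MonoidHom.toMulEquiv (PresentedGroup.toGroup lift_kleinRels_eq_one) (KB.lift of_conj_eq_inv)
    (by
      ext i
      fin_cases i <;> simp [KB.a, KB.f])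
    (by
      ext1 p
      simp [KB.a_zpow_mul_f_zpow])

lemma presentedGroupEquiv_of_zero : presentedGroupEquiv (PresentedGroup.of 0) = KB.a :=
  PresentedGroup.toGroup.of lift_kleinRels_eq_one

lemma presentedGroupEquiv_of_one : presentedGroupEquiv (PresentedGroup.of 1) = KB.f :=
  PresentedGroup.toGroup.of lift_kleinRels_eq_one

open KB in
/-- the presented group `⟨a,f | a f a⁻¹ = f⁻¹⟩` is isomorphic to the
Klein-bottle group `K` via `a ↦ (1,0)`, `f ↦ (0,1)`; equivalently, every element of
the presented group has a unique normal form `aⁿ f^l` with `n, l ∈ ℤ`. -/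
theorem presentation_KB :
    (∃ φ : PresentedGroup kleinRels ≃* KB,
      φ (PresentedGroup.of 0) = a ∧ φ (PresentedGroup.of 1) = f) ∧
    (∀ x : PresentedGroup kleinRels, ∃! p : ℤ × ℤ,
      x = (PresentedGroup.of 0 : PresentedGroup kleinRels) ^ p.1 *
          (PresentedGroup.of 1 : PresentedGroup kleinRels) ^ p.2) := by
  refine ⟨⟨presentedGroupEquiv, presentedGroupEquiv_of_zero, presentedGroupEquiv_of_one⟩,
    fun x => ?_⟩
  have key (p : ℤ × ℤ) : x = (PresentedGroup.of 0 : PresentedGroup kleinRels) ^ p.1 *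
      (PresentedGroup.of 1 : PresentedGroup kleinRels) ^ p.2 ↔
      presentedGroupEquiv x = ⟨p.1, p.2⟩ := by
    rw [← presentedGroupEquiv.injective.eq_iff, map_mul, map_zpow, map_zpow,
      presentedGroupEquiv_of_zero, presentedGroupEquiv_of_one, a_zpow_mul_f_zpow]
  refine ⟨((presentedGroupEquiv x).n, (presentedGroupEquiv x).l), (key _).mpr rfl,
    fun p hp => ?_⟩
  rw [(key p).mp hp]

end Paper
end

section
/- Let G = ⟨f⟩ be an infinite cyclic group written multiplicatively and let T₁(G) be the single-label order-1 intersection-tree group, with (g,h) denoting the class of Y(∗,∗,∗;1,g,h). For each r ∈ ℤ set Δ_r := (f, f^r) + (f⁻¹, f^r) + (f³, f^r) + (f⁻³, f^r) ∈ T₁(G). Then the element (f,f) + (f⁻¹,f) + (f³,f³) + (f⁻³,f³) does NOT lie in the subgroup of T₁(G) generated by { Δ_r : r ∈ ℤ }; that is, it is not equal to any finite integer combination Σ d_r·Δ_r. -/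
namespace Paper

variable (G : Type) [Group G] (ι : Type)

/-- A weight on the increasing triples of integers `a < b < c`, depending only on the gaps
`b - a` and `c - b`. -/
def gapWeight (a b c : ℤ) : ZMod 2 :=
  if a < b ∧ b < c ∧ (b - a = 3 ∨ (c - b = 3 ∧ b - a ≠ 1) ∨ (b - a = 1 ∧ c - b = 2)) then 1 else 0

/-- The symmetrization of `gapWeight`. -/
def symWeight (a b c : ℤ) : ZMod 2 :=
  gapWeight a b c + gapWeight b c a + gapWeight c a b
    + gapWeight a c b + gapWeight c b a + gapWeight b a c

lemma symWeight_rotate (a b c : ℤ) : symWeight a b c = symWeight b c a := by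
  unfold symWeight; ring

lemma symWeight_swap (a b c : ℤ) : symWeight a b c = symWeight a c b := by
  unfold symWeight; ring

lemma symWeight_add_right (a b c t : ℤ) :
    symWeight (a + t) (b + t) (c + t) = symWeight a b c := by
  simp only [symWeight, gapWeight, add_lt_add_iff_right, add_sub_add_right_eq_sub]

lemma symWeight_self_right (a b : ℤ) : symWeight a b b = 0 := by
  have h : symWeight a b b
      = (gapWeight a b b + gapWeight b b a + gapWeight b a b)
        + (gapWeight a b b + gapWeight b b a + gapWeight b a b) := by
    unfold symWeight; ring
  rw [h, CharTwo.add_self_eq_zero]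

lemma symWeight_zero_one (r : ℤ) :
    symWeight 0 1 r = if r = 3 ∨ r = -3 then 1 else 0 := by
  unfold symWeight gapWeight
  grind

lemma symWeight_zero_three (r : ℤ) :
    symWeight 0 3 r = if 3 < r ∨ r = 1 ∨ r ≤ -2 then 1 else 0 := by
  unfold symWeight gapWeight
  grind

lemma symWeight_zero_neg (m r : ℤ) : symWeight 0 (-m) r = symWeight 0 m (r + m) := by
  rw [← symWeight_add_right 0 (-m) r m, symWeight_rotate, symWeight_swap, neg_add_cancel,
    zero_add]

lemma symWeight_sum_eq_zero (r : ℤ) :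
    symWeight 0 1 r + symWeight 0 (-1) r + symWeight 0 3 r + symWeight 0 (-3) r = 0 := by
  have h2 : (1 + 1 : ZMod 2) = 0 := CharTwo.add_self_eq_zero 1
  simp only [symWeight_zero_neg, symWeight_zero_one, symWeight_zero_three]
  grind

/-- The homomorphism `T₁(G) → ℤ/2` induced by `symWeight` and a homomorphism `e : G → ℤ`. -/
def weightHom {G : Type} [Group G] (e : G →* Multiplicative ℤ) : T1 G Unit →+ ZMod 2 :=
  QuotientAddGroup.lift _
    (FreeAbelianGroup.lift fun x : Unit × Unit × Unit × G × G × G =>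
      symWeight (e x.2.2.2.1).toAdd (e x.2.2.2.2.1).toAdd (e x.2.2.2.2.2).toAdd) <| by
    rw [AddSubgroup.closure_le]
    rintro x (⟨i, j, k, a, b, c, rfl⟩ | ⟨i, j, k, a, b, c, rfl⟩ | ⟨i, j, k, a, b, c, g, rfl⟩ |
      ⟨i, j, a, b, rfl⟩) <;>
    simp only [SetLike.mem_coe, AddMonoidHom.mem_ker, map_sub, map_add, map_mul, toAdd_mul,
      FreeAbelianGroup.lift_apply_of]
    · rw [symWeight_rotate, sub_self]
    · rw [symWeight_swap, CharTwo.add_self_eq_zero]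
    · rw [symWeight_add_right, sub_self]
    · rw [symWeight_rotate (e a).toAdd (e b).toAdd (e a).toAdd, symWeight_self_right,
        symWeight_self_right, sub_self]

lemma weightHom_pairY {G : Type} [Group G] (e : G →* Multiplicative ℤ) (g h : G) :
    weightHom e (pairY G g h) = symWeight 0 (e g).toAdd (e h).toAdd := by
  simp [weightHom, pairY, Y]

lemma exists_hom_zpow {G : Type} [Group G] (f : G) (htf : ∀ n : ℤ, f ^ n = 1 → n = 0)
    (hgen : ∀ g : G, ∃ n : ℤ, g = f ^ n) :
    ∃ e : G →* Multiplicative ℤ, e f = Multiplicative.ofAdd 1 := by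
  have hbij : Function.Bijective (zpowersHom G f) := by
    refine ⟨(injective_iff_map_eq_one _).2 fun n hn => ?_, fun g => ?_⟩
    · exact htf n.toAdd (by simpa using hn)
    · obtain ⟨n, rfl⟩ := hgen g
      exact ⟨Multiplicative.ofAdd n, by simp⟩
  refine ⟨(MulEquiv.ofBijective _ hbij).symm.toMonoidHom, ?_⟩
  rw [MulEquiv.coe_toMonoidHom, MulEquiv.symm_apply_eq]
  simp

/-- for `G = ⟨f⟩` infinite cyclic,
`(f,f) + (f⁻¹,f) + (f³,f³) + (f⁻³,f³)` does not lie in the subgroup of `T₁(G)`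
generated by the elements `Δ_r = (f,f^r) + (f⁻¹,f^r) + (f³,f^r) + (f⁻³,f^r)`, `r ∈ ℤ`. -/
theorem not_in_INT_span (G : Type) [Group G] (f : G)
    (htf : ∀ n : ℤ, f ^ n = 1 → n = 0)
    (hgen : ∀ g : G, ∃ n : ℤ, g = f ^ n) :
    pairY G f f + pairY G f⁻¹ f + pairY G (f ^ (3:ℤ)) (f ^ (3:ℤ))
        + pairY G (f ^ (-3:ℤ)) (f ^ (3:ℤ)) ∉
      AddSubgroup.closure (Set.range (fun r : ℤ =>
        pairY G f (f ^ r) + pairY G f⁻¹ (f ^ r) + pairY G (f ^ (3:ℤ)) (f ^ r)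
          + pairY G (f ^ (-3:ℤ)) (f ^ r))) := by
  obtain ⟨e, he⟩ := exists_hom_zpow f htf hgen
  intro hmem
  have hker := (AddSubgroup.closure_le (K := (weightHom e).ker)).2 (by
    rintro _ ⟨r, rfl⟩
    simpa [AddMonoidHom.mem_ker, weightHom_pairY, he] using symWeight_sum_eq_zero r) hmem
  have hval : symWeight 0 1 1 + symWeight 0 (-1) 1 + symWeight 0 3 3 + symWeight 0 (-3) 3 = 0 := by
    simpa [AddMonoidHom.mem_ker, weightHom_pairY, he] using hker
  revert hval
  decide

end Paper
end
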